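/- arXiv:1208.3732 — 3 statements merged into one kernel-verified Lean document; each statement's English description precedes it below -/
import Mathlib

section
/- Let N ≥ 4 be a real number and let y be a smooth function on [0,1] whose support is a compact subset of the open interval (0,1). Then for all integers 0 ≤ j ≤ m: ‖Δ^j y‖_𝔛 ≤ ‖Δ^m y‖_𝔛. -/
open MeasureTheory Real Set

noncomputable section

/-- The degenerate operator `Δy(z) = z y''(z) + (N/2) y'(z)`. -/
def Del (N : ℝ) (f : ℝ → ℝ) : ℝ → ℝ :=
  fun z => z * deriv (deriv f) z + (N / 2) * deriv f z

/-- Iterates `Δ^m`. -/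
def DelIter (N : ℝ) : ℕ → (ℝ → ℝ) → ℝ → ℝ
  | 0 => fun f => f
  | m + 1 => fun f => Del N (DelIter N m f)

/-- `Ḋ = √z d/dz`. -/
def Ddot (f : ℝ → ℝ) : ℝ → ℝ := fun z => Real.sqrt z * deriv f z

/-- The weighted L² norm on (0,1). -/
def Xnorm (N : ℝ) (f : ℝ → ℝ) : ℝ :=
  Real.sqrt (∫ z in (0:ℝ)..1, (f z) ^ 2 * z ^ (N / 2 - 1))

/-- Graded seminorms `(y)_ℓ`. -/
def gnorm (N : ℝ) (ℓ : ℕ) (f : ℝ → ℝ) : ℝ :=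
  if ℓ % 2 = 0 then Xnorm N (DelIter N (ℓ / 2) f)
  else Xnorm N (Ddot (DelIter N (ℓ / 2) f))

/-- Graded norm `‖y‖_n`. -/
def normN (N : ℝ) (n : ℕ) (f : ℝ → ℝ) : ℝ :=
  Real.sqrt (∑ ℓ ∈ Finset.range (n + 1), (gnorm N ℓ f) ^ 2)

/-- Sup norm on [0,1]. -/
def supN (f : ℝ → ℝ) : ℝ := ⨆ z : Icc (0:ℝ) 1, |f z.1|

/-- `|y|_n = ∑_{ℓ≤n} ‖Ḋ^ℓ y‖_{L^∞(0,1)}`. -/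
def supLow (n : ℕ) (f : ℝ → ℝ) : ℝ := ∑ ℓ ∈ Finset.range (n + 1), supN (Ddot^[ℓ] f)

/-- Time derivative of a function of (t,z). -/
def dt (y : ℝ → ℝ → ℝ) : ℝ → ℝ → ℝ := fun t z => deriv (fun s => y s z) t

/-- Sup norm on [0,T]×[0,1]. -/
def supT (T : ℝ) (y : ℝ → ℝ → ℝ) : ℝ :=
  ⨆ (t : Icc (0:ℝ) T) (z : Icc (0:ℝ) 1), |y t.1 z.1|

/-- `|y|_n^T = sup_{j+k≤n} ‖∂_t^j Ḋ^k y‖_{L^∞([0,T]×[0,1])}`. -/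
def supNT (T : ℝ) (n : ℕ) (y : ℝ → ℝ → ℝ) : ℝ :=
  ⨆ p : {p : ℕ × ℕ // p.1 + p.2 ≤ n}, supT T (fun t => Ddot^[p.1.2] (dt^[p.1.1] y t))

/-- `‖y‖_n^T`. -/
def normT (N T : ℝ) (n : ℕ) (y : ℝ → ℝ → ℝ) : ℝ :=
  Real.sqrt (∑ j ∈ Finset.range (n + 1), ∑ k ∈ Finset.range (n + 1 - j),
    ∫ t in (0:ℝ)..T, (normN N k (dt^[j] y t)) ^ 2)

/-- `Z_n(H)(t) = ∑_{j+k=n} ‖∂_t^j H(t,·)‖_k`. -/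
def ZZ (N : ℝ) (n : ℕ) (H : ℝ → ℝ → ℝ) (t : ℝ) : ℝ :=
  ∑ j ∈ Finset.range (n + 1), normN N (n - j) (dt^[j] H t)

/-- The operator `𝒜h = -b₂ Δh + b₁ Ďh + b₀ h` with time-dependent coefficients. -/
def opA (N : ℝ) (b₂ b₁ b₀ : ℝ → ℝ → ℝ) (H : ℝ → ℝ → ℝ) : ℝ → ℝ → ℝ :=
  fun t z => -(b₂ t z) * Del N (H t) z + b₁ t z * (z * deriv (H t) z) + b₀ t z * H t z

end

lemma smooth_Del (N : ℝ) (f : ℝ → ℝ) (hf : ContDiff ℝ (⊤ : ℕ∞) f) :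
    ContDiff ℝ (⊤ : ℕ∞) (Del N f) := by
  have h1 : ContDiff ℝ (⊤ : ℕ∞) (deriv f) := (contDiff_infty_iff_deriv.1 hf).2
  have h2 : ContDiff ℝ (⊤ : ℕ∞) (deriv (deriv f)) := (contDiff_infty_iff_deriv.1 h1).2
  unfold Del
  fun_prop

lemma tsupport_Del (N : ℝ) (f : ℝ → ℝ) : tsupport (Del N f) ⊆ tsupport f := by
  apply closure_minimal _ (isClosed_tsupport f)
  intro z hz
  by_contra h
  have h1 : z ∉ tsupport (deriv f) := fun h' => h (tsupport_deriv_subset (𝕜 := ℝ) h')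
  have h2 : z ∉ tsupport (deriv (deriv f)) := fun h' => h1 (tsupport_deriv_subset (𝕜 := ℝ) h')
  apply hz
  simp [Del, image_eq_zero_of_notMem_tsupport h1, image_eq_zero_of_notMem_tsupport h2]

lemma step_Del (N : ℝ) (hN : 4 ≤ N) (f : ℝ → ℝ) (hf : ContDiff ℝ (⊤ : ℕ∞) f)
    (hs : tsupport f ⊆ Ioo (0:ℝ) 1) : Xnorm N f ≤ Xnorm N (Del N f) := by
  have h1 : ContDiff ℝ (⊤ : ℕ∞) (deriv f) := (contDiff_infty_iff_deriv.1 hf).2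
  have h2 : ContDiff ℝ (⊤ : ℕ∞) (deriv (deriv f)) := (contDiff_infty_iff_deriv.1 h1).2
  have f0 : f 0 = 0 := image_eq_zero_of_notMem_tsupport fun h => by simpa using hs h
  have f1 : f 1 = 0 := image_eq_zero_of_notMem_tsupport fun h => by simpa using hs h
  have cf := hf.continuous
  have c1 := h1.continuous
  have c2 := h2.continuous
  have cD := (smooth_Del N f hf).continuous
  have cw : Continuous fun z : ℝ => z ^ (N / 2 - 1) :=
    Real.continuous_rpow_const (by linarith)
  have ca : Continuous fun z : ℝ => z ^ (N / 2) :=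
    Real.continuous_rpow_const (by linarith)
  have key : ∀ z : ℝ, HasDerivAt (fun z => z ^ (N / 2) * (2 * f z * (deriv f z + f z)))
      ((N / 2) * z ^ (N / 2 - 1) * (2 * f z * (deriv f z + f z)) +
        z ^ (N / 2) * (2 * deriv f z * (deriv f z + f z)
          + 2 * f z * (deriv (deriv f) z + deriv f z))) z := by
    intro z
    have d0 : HasDerivAt f (deriv f z) z := (hf.differentiable (by simp) z).hasDerivAt
    have d1 : HasDerivAt (deriv f) (deriv (deriv f) z) z :=
      (h1.differentiable (by simp) z).hasDerivAt
    exact (Real.hasDerivAt_rpow_const (Or.inr (by linarith))).mul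
      ((d0.const_mul 2).mul (d1.add d0))
  have hint := intervalIntegral.integral_eq_sub_of_hasDerivAt (a := 0) (b := 1)
    (fun z _ => key z) (Continuous.intervalIntegrable (by fun_prop) _ _)
  simp only [f0, f1, mul_zero, zero_mul, sub_zero] at hint
  unfold Xnorm
  apply Real.sqrt_le_sqrt
  rw [← sub_nonpos, ← intervalIntegral.integral_sub
    (Continuous.intervalIntegrable (by fun_prop) _ _)
    (Continuous.intervalIntegrable (by fun_prop) _ _)]
  refine le_trans ?_ hint.le
  apply intervalIntegral.integral_mono_on zero_le_one
    (Continuous.intervalIntegrable (by fun_prop) _ _)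
    (Continuous.intervalIntegrable (by fun_prop) _ _)
  intro z hz
  have hw : 0 ≤ z ^ (N / 2 - 1) := Real.rpow_nonneg hz.1 _
  have hza : z ^ (N / 2) = z * z ^ (N / 2 - 1) := by
    rw [← Real.rpow_one_add' hz.1 (by linarith)]
    congr 1
    ring
  rw [hza, ← sub_nonneg]
  have hpos : 0 ≤ (f z + Del N f z) ^ 2 + 2 * z * (deriv f z + f z) ^ 2
      + (N - 2 - 2 * z) * f z ^ 2 := by
    have := hz.1
    have : 0 ≤ N - 2 - 2 * z := by linarith [hz.2]
    positivity
  have := mul_nonneg hw hpos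
  refine this.trans_eq ?_
  simp only [Del]
  ring

theorem stmt16 (N : ℝ) (hN : 4 ≤ N) (y : ℝ → ℝ) (hy : ContDiff ℝ (⊤ : ℕ∞) y)
    (hsupp : IsCompact (tsupport y) ∧ tsupport y ⊆ Ioo (0:ℝ) 1) :
    ∀ j m : ℕ, j ≤ m →
      Xnorm N (DelIter N j y) ≤ Xnorm N (DelIter N m y) := by
  have inv : ∀ k, ContDiff ℝ (⊤ : ℕ∞) (DelIter N k y) ∧
      tsupport (DelIter N k y) ⊆ Ioo (0:ℝ) 1 := by
    intro k
    induction k with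
    | zero => exact ⟨hy, hsupp.2⟩
    | succ k ih => exact ⟨smooth_Del N _ ih.1, (tsupport_Del N _).trans ih.2⟩
  intro j m hjm
  exact monotone_nat_of_le_succ
    (f := fun k => Xnorm N (DelIter N k y))
    (fun k => step_Del N hN _ (inv k).1 (inv k).2) hjm
end

section
/- Let N ≥ 4 be a real number and let s be a positive integer with 2s > N/2. Then there is a constant C = C(s, N) such that for every y ∈ C^∞([0,1]): ‖y‖_{L^∞(0,1)} ≤ C · sup_{0≤j≤s} ‖Δ^j y‖_𝔛. -/
open MeasureTheory Real Set

theorem DelIter_smooth (N : ℝ) (y : ℝ → ℝ) (hy : ContDiff ℝ (⊤ : ℕ∞) y) (m : ℕ) :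
    ContDiff ℝ (⊤ : ℕ∞) (DelIter N m y) := by
  induction m with
  | zero => exact hy
  | succ m ih =>
    have h1 : ContDiff ℝ (⊤ : ℕ∞) (deriv (DelIter N m y)) := (contDiff_infty_iff_deriv.1 ih).2
    have h2 : ContDiff ℝ (⊤ : ℕ∞) (deriv (deriv (DelIter N m y))) :=
      (contDiff_infty_iff_deriv.1 h1).2
    change ContDiff ℝ (⊤ : ℕ∞)
      (fun z => z * deriv (deriv (DelIter N m y)) z + (N / 2) * deriv (DelIter N m y) z)
    exact (contDiff_id.mul h2).add (contDiff_const.mul h1)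

/-- FTC for `z^a F`. -/
theorem ftc_pow (a : ℝ) (ha : 2 ≤ a) (F : ℝ → ℝ) (hF : ContDiff ℝ (⊤ : ℕ∞) F) (z : ℝ)
    (hz : 0 < z) :
    ∫ t in (0:ℝ)..z, t ^ (a - 1) * (a * F t + t * deriv F t) = z ^ a * F z := by
  have hF1 : ContDiff ℝ (⊤ : ℕ∞) (deriv F) := (contDiff_infty_iff_deriv.1 hF).2
  have hd : Differentiable ℝ F := (contDiff_infty_iff_deriv.1 hF).1
  have hc : Continuous (fun t : ℝ => t ^ (a - 1)) := continuous_id.rpow_const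
    (fun x => Or.inr (by linarith))
  have hc' : Continuous (fun t : ℝ => t ^ a) := continuous_id.rpow_const
    (fun x => Or.inr (by linarith))
  have key := intervalIntegral.integral_eq_sub_of_hasDerivAt_of_le (a := 0) (b := z) hz.le
    (f := fun t => t ^ a * F t) (f' := fun t => t ^ (a - 1) * (a * F t + t * deriv F t))
    (hc'.mul hF.continuous).continuousOn ?_ ?_
  · rw [key, Real.zero_rpow (by linarith)]; ring
  · intro t ht
    have h1 := (Real.hasDerivAt_rpow_const (x := t) (p := a) (Or.inl ht.1.ne')).mul
      (hd t).hasDerivAt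
    have : t ^ a = t ^ (a - 1) * t := by
      rw [← Real.rpow_add_one ht.1.ne']; congr 1; ring
    have e : a * t ^ (a - 1) * F t + t ^ a * deriv F t
        = t ^ (a - 1) * (a * F t + t * deriv F t) := by rw [this]; ring
    rw [e] at h1
    exact h1
  · apply Continuous.intervalIntegrable
    exact hc.mul ((continuous_const.mul hF.continuous).add (continuous_id.mul hF1.continuous))

theorem cauchy_X (N : ℝ) (hN : 4 ≤ N) (g : ℝ → ℝ) (hg : Continuous g) (M : ℝ) (hM : 0 < M)
    (hX : Xnorm N g ≤ M) (z : ℝ) (hz : 0 < z) (hz1 : z ≤ 1) :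
    |∫ t in (0:ℝ)..z, t ^ (N / 2 - 1) * g t| ≤ z ^ (N / 2 / 2) * M := by
  set a := N / 2 with ha
  have ha2 : 2 ≤ a := by linarith
  have hc : Continuous (fun t : ℝ => t ^ (a - 1)) := continuous_id.rpow_const
    (fun x => Or.inr (by linarith))
  have hcg : Continuous (fun t : ℝ => (g t) ^ 2 * t ^ (a - 1)) := (hg.pow 2).mul hc
  have hI : ∫ t in (0:ℝ)..1, (g t) ^ 2 * t ^ (a - 1) ≤ M ^ 2 := by
    have := (Real.sqrt_le_left hM.le).1 hX
    exact this
  have hIz : ∫ t in (0:ℝ)..z, (g t) ^ 2 * t ^ (a - 1) ≤ M ^ 2 := by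
    refine le_trans ?_ hI
    apply intervalIntegral.integral_mono_interval le_rfl hz.le hz1
    · refine (ae_restrict_iff' measurableSet_Ioc).2 (Filter.Eventually.of_forall ?_)
      intro t ht
      exact mul_nonneg (sq_nonneg _) (Real.rpow_nonneg ht.1.le _)
    · exact hcg.intervalIntegrable _ _
  set w := z ^ (a / 2) with hw
  have hwpos : 0 < w := Real.rpow_pos_of_pos hz _
  have hww : z ^ a = w * w := by
    rw [hw, ← Real.rpow_add hz]; congr 1; ring
  have hpow : ∫ t in (0:ℝ)..z, t ^ (a - 1) = w * w / a := by
    rw [integral_rpow (Or.inl (by linarith)), ← hww]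
    have : a - 1 + 1 = a := by ring
    rw [this, Real.zero_rpow (by linarith), sub_zero]
  have hb : ‖∫ t in (0:ℝ)..z, t ^ (a - 1) * g t‖ ≤
      ∫ t in (0:ℝ)..z, ((w / M / 2) * ((g t) ^ 2 * t ^ (a - 1)) + (M / w / 2) * t ^ (a - 1)) := by
    apply intervalIntegral.norm_integral_le_of_norm_le hz.le
    · refine Filter.Eventually.of_forall ?_
      intro t ht
      have ht' : 0 ≤ t ^ (a - 1) := Real.rpow_nonneg ht.1.le _
      rw [Real.norm_eq_abs, abs_mul, abs_of_nonneg ht']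
      have : |g t| ≤ (w / M / 2) * (g t) ^ 2 + (M / w / 2) := by
        rw [← sq_abs (g t)]
        have h : (w / M / 2) * |g t| ^ 2 + (M / w / 2) - |g t|
            = (w * |g t| - M) ^ 2 / (2 * M * w) := by
          field_simp; ring
        have : 0 ≤ (w * |g t| - M) ^ 2 / (2 * M * w) := by positivity
        linarith
      calc t ^ (a - 1) * |g t| ≤ t ^ (a - 1) * ((w / M / 2) * (g t) ^ 2 + (M / w / 2)) :=
            mul_le_mul_of_nonneg_left this ht'
        _ = _ := by ring
    · exact ((continuous_const.mul hcg).add (continuous_const.mul hc)).intervalIntegrable _ _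
  rw [intervalIntegral.integral_add ((hcg.intervalIntegrable _ _).const_mul _)
    ((hc.intervalIntegrable _ _).const_mul _), intervalIntegral.integral_const_mul,
    intervalIntegral.integral_const_mul, hpow, Real.norm_eq_abs] at hb
  refine hb.trans ?_
  have h1 : w / M / 2 * (∫ t in (0:ℝ)..z, (g t) ^ 2 * t ^ (a - 1)) ≤ w / M / 2 * M ^ 2 :=
    mul_le_mul_of_nonneg_left hIz (by positivity)
  have h2 : w / M / 2 * M ^ 2 = w * M / 2 := by field_simp
  have h3 : M / w / 2 * (w * w / a) = (w * M / 2) * (1 / a) := by field_simp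
  have h4 : 1 / a ≤ 1 := by rw [div_le_one (by linarith)]; linarith
  have h5 : (w * M / 2) * (1 / a) ≤ (w * M / 2) * 1 :=
    mul_le_mul_of_nonneg_left h4 (by positivity)
  linarith

theorem ftc_Del (N : ℝ) (hN : 4 ≤ N) (g : ℝ → ℝ) (hg : ContDiff ℝ (⊤ : ℕ∞) g) (z : ℝ)
    (hz : 0 < z) :
    ∫ t in (0:ℝ)..z, t ^ (N / 2 - 1) * Del N g t = z ^ (N / 2) * deriv g z := by
  rw [← ftc_pow (N / 2) (by linarith) (deriv g) (contDiff_infty_iff_deriv.1 hg).2 z hz]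
  congr 1; funext t; simp only [Del]; ring

theorem deriv_of_X (N : ℝ) (hN : 4 ≤ N) (g : ℝ → ℝ) (hg : ContDiff ℝ (⊤ : ℕ∞) g)
    (hD : Continuous (Del N g)) (M : ℝ) (hM : 0 < M)
    (hX : Xnorm N (Del N g) ≤ M) (z : ℝ) (hz : 0 < z) (hz1 : z ≤ 1) :
    |deriv g z| ≤ M * z ^ (-(N / 2 / 2)) := by
  have h := cauchy_X N hN (Del N g) hD M hM hX z hz hz1
  rw [ftc_Del N hN g hg z hz, abs_mul, abs_of_pos (Real.rpow_pos_of_pos hz _)] at h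
  have h2 : z ^ (N / 2) = z ^ (N / 2 / 2) * z ^ (N / 2 / 2) := by
    rw [← Real.rpow_add hz]; congr 1; ring
  have hp : 0 < z ^ (N / 2 / 2) := Real.rpow_pos_of_pos hz _
  rw [h2, mul_assoc] at h
  have h3 := le_of_mul_le_mul_left h hp
  rw [Real.rpow_neg hz.le, ← div_eq_mul_inv, le_div_iff₀ hp]
  linarith

theorem deriv_of_pt (N : ℝ) (hN : 4 ≤ N) (g : ℝ → ℝ) (hg : ContDiff ℝ (⊤ : ℕ∞) g)
    (K γ : ℝ) (hK : 0 < K) (hγ : γ ≤ N / 2 / 2)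
    (hX : ∀ z, 0 < z → z ≤ 1 → |Del N g z| ≤ K * z ^ (-γ)) (z : ℝ) (hz : 0 < z) (hz1 : z ≤ 1) :
    |deriv g z| ≤ K * z ^ (-γ) := by
  have hb : ‖∫ t in (0:ℝ)..z, t ^ (N / 2 - 1) * Del N g t‖ ≤
      ∫ t in (0:ℝ)..z, K * t ^ (N / 2 - 1 - γ) := by
    apply intervalIntegral.norm_integral_le_of_norm_le hz.le
    · refine Filter.Eventually.of_forall ?_
      intro t ht
      have ht' : 0 ≤ t ^ (N / 2 - 1) := Real.rpow_nonneg ht.1.le _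
      rw [Real.norm_eq_abs, abs_mul, abs_of_nonneg ht']
      calc t ^ (N / 2 - 1) * |Del N g t| ≤ t ^ (N / 2 - 1) * (K * t ^ (-γ)) :=
            mul_le_mul_of_nonneg_left (hX t ht.1 (ht.2.trans hz1)) ht'
        _ = K * (t ^ (N / 2 - 1) * t ^ (-γ)) := by ring
        _ = _ := by rw [← Real.rpow_add ht.1]; rfl
    · apply Continuous.intervalIntegrable
      exact continuous_const.mul (continuous_id.rpow_const (fun x => Or.inr (by linarith)))
  rw [ftc_Del N hN g hg z hz, intervalIntegral.integral_const_mul,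
    integral_rpow (Or.inl (by linarith)), Real.norm_eq_abs, abs_mul,
    abs_of_pos (Real.rpow_pos_of_pos hz _), Real.zero_rpow (by linarith), sub_zero] at hb
  have e1 : N / 2 - 1 - γ + 1 = N / 2 + (-γ) := by ring
  rw [e1, Real.rpow_add hz] at hb
  have hp : 0 < z ^ (N / 2) := Real.rpow_pos_of_pos hz _
  have hq : 0 < z ^ (-γ) := Real.rpow_pos_of_pos hz _
  have h2 : K * (z ^ (N / 2) * z ^ (-γ) / (N / 2 + -γ)) ≤ z ^ (N / 2) * (K * z ^ (-γ)) := by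
    have : z ^ (N / 2) * z ^ (-γ) / (N / 2 + -γ) ≤ z ^ (N / 2) * z ^ (-γ) :=
      div_le_self (by positivity) (by linarith)
    calc _ ≤ K * (z ^ (N / 2) * z ^ (-γ)) := mul_le_mul_of_nonneg_left this hK.le
      _ = _ := by ring
  exact le_of_mul_le_mul_left (hb.trans h2) hp

theorem at_one (N : ℝ) (hN : 4 ≤ N) (g : ℝ → ℝ) (hg : ContDiff ℝ (⊤ : ℕ∞) g)
    (M : ℝ) (hM : 0 < M) (hX : Xnorm N g ≤ M)
    (K γ : ℝ) (hK : 0 < K) (hγ : γ ≤ N / 2 / 2)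
    (hd : ∀ z, 0 < z → z ≤ 1 → |deriv g z| ≤ K * z ^ (-γ)) :
    |g 1| ≤ N / 2 * M + K := by
  have h := ftc_pow (N / 2) (by linarith) g hg 1 one_pos
  have hc : Continuous (fun t : ℝ => t ^ (N / 2 - 1)) := continuous_id.rpow_const
    (fun x => Or.inr (by linarith))
  have hg1 : Continuous (deriv g) := (contDiff_infty_iff_deriv.1 hg).2.continuous
  have hsplit : ∫ t in (0:ℝ)..1, t ^ (N / 2 - 1) * (N / 2 * g t + t * deriv g t) =
      N / 2 * (∫ t in (0:ℝ)..1, t ^ (N / 2 - 1) * g t) +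
      ∫ t in (0:ℝ)..1, t ^ (N / 2 - 1) * (t * deriv g t) := by
    rw [← intervalIntegral.integral_const_mul, ← intervalIntegral.integral_add]
    · congr 1; funext t; ring
    · exact (continuous_const.mul (hc.mul hg.continuous)).intervalIntegrable _ _
    · exact (hc.mul (continuous_id.mul hg1)).intervalIntegrable _ _
  rw [hsplit, Real.one_rpow, one_mul] at h
  have h1 := cauchy_X N hN g hg.continuous M hM hX 1 one_pos le_rfl
  rw [Real.one_rpow, one_mul] at h1
  have h2 : ‖∫ t in (0:ℝ)..1, t ^ (N / 2 - 1) * (t * deriv g t)‖ ≤ K * |1 - 0| := by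
    apply intervalIntegral.norm_integral_le_of_norm_le_const
    intro t ht
    rw [uIoc_of_le zero_le_one] at ht
    have ht' : 0 ≤ t ^ (N / 2 - 1) := Real.rpow_nonneg ht.1.le _
    rw [Real.norm_eq_abs, abs_mul, abs_mul, abs_of_nonneg ht', abs_of_pos ht.1]
    calc t ^ (N / 2 - 1) * (t * |deriv g t|) ≤ t ^ (N / 2 - 1) * (t * (K * t ^ (-γ))) :=
          mul_le_mul_of_nonneg_left
            (mul_le_mul_of_nonneg_left (hd t ht.1 ht.2) ht.1.le) ht'
      _ = K * (t ^ (N / 2 - 1) * t ^ (1:ℝ) * t ^ (-γ)) := by rw [Real.rpow_one]; ring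
      _ = K * t ^ (N / 2 - 1 + 1 + -γ) := by rw [← Real.rpow_add ht.1, ← Real.rpow_add ht.1]
      _ ≤ K * 1 := mul_le_mul_of_nonneg_left
          (Real.rpow_le_one ht.1.le ht.2 (by linarith)) hK.le
      _ = K := mul_one K
  rw [Real.norm_eq_abs] at h2
  norm_num at h2
  rw [← h]
  refine (abs_add_le _ _).trans ?_
  rw [abs_mul, abs_of_pos (show (0:ℝ) < N / 2 by linarith)]
  have := mul_le_mul_of_nonneg_left h1 (show (0:ℝ) ≤ N / 2 by linarith)
  linarith

theorem pt_of_deriv (N : ℝ) (hN : 4 ≤ N) (g : ℝ → ℝ) (hg : ContDiff ℝ (⊤ : ℕ∞) g)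
    (M : ℝ) (hM : 0 < M) (hX : Xnorm N g ≤ M)
    (K γ θ : ℝ) (hK : 0 < K) (hγ : γ ≤ N / 2 / 2) (hθ : θ < 1) (hθγ : θ ≤ γ)
    (hd : ∀ z, 0 < z → z ≤ 1 → |deriv g z| ≤ K * z ^ (-γ)) (z : ℝ) (hz : 0 < z) (hz1 : z ≤ 1) :
    |g z| ≤ (N / 2 * M + K + K / (1 - θ)) * z ^ (-(γ - θ)) := by
  have h1 := at_one N hN g hg M hM hX K γ hK hγ hd
  have hdiff : Differentiable ℝ g := (contDiff_infty_iff_deriv.1 hg).1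
  have hg1 : Continuous (deriv g) := (contDiff_infty_iff_deriv.1 hg).2.continuous
  have hftc : ∫ t in z..1, deriv g t = g 1 - g z :=
    intervalIntegral.integral_deriv_eq_sub (fun t _ => hdiff t) (hg1.intervalIntegrable _ _)
  have hth : 0 < 1 - θ := by linarith
  set Q := z ^ (-(γ - θ)) with hQ
  have hQ1 : 1 ≤ Q := Real.one_le_rpow_of_pos_of_le_one_of_nonpos hz hz1 (by linarith)
  have hb : ‖∫ t in z..1, deriv g t‖ ≤ ∫ t in z..1, (K * Q) * t ^ (-θ) := by
    apply intervalIntegral.norm_integral_le_of_norm_le hz1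
    · refine Filter.Eventually.of_forall ?_
      intro t ht
      have ht0 : 0 < t := hz.trans ht.1
      rw [Real.norm_eq_abs]
      have e : t ^ (-γ) = t ^ (-(γ - θ)) * t ^ (-θ) := by
        rw [← Real.rpow_add ht0]; congr 1; ring
      have h3 : t ^ (-(γ - θ)) ≤ Q :=
        Real.rpow_le_rpow_of_nonpos hz ht.1.le (by linarith)
      calc |deriv g t| ≤ K * t ^ (-γ) := hd t ht0 ht.2
        _ = K * t ^ (-(γ - θ)) * t ^ (-θ) := by rw [e]; ring
        _ ≤ K * Q * t ^ (-θ) := mul_le_mul_of_nonneg_right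
            (mul_le_mul_of_nonneg_left h3 hK.le) (Real.rpow_nonneg ht0.le _)
    · exact (intervalIntegral.intervalIntegrable_rpow' (by linarith)).const_mul _
  rw [intervalIntegral.integral_const_mul, integral_rpow (Or.inl (by linarith)), Real.one_rpow,
    hftc, Real.norm_eq_abs] at hb
  have e2 : -θ + 1 = 1 - θ := by ring
  rw [e2] at hb
  have h4 : (1 - z ^ (1 - θ)) / (1 - θ) ≤ 1 / (1 - θ) := by
    apply div_le_div_of_nonneg_right _ hth.le
    have := Real.rpow_nonneg hz.le (1 - θ)
    linarith
  have h5 : K * Q * ((1 - z ^ (1 - θ)) / (1 - θ)) ≤ K * Q * (1 / (1 - θ)) :=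
    mul_le_mul_of_nonneg_left h4 (by positivity)
  have h6 : |g z| ≤ |g 1| + |g 1 - g z| := by
    have := abs_sub (g 1) (g 1 - g z)
    simpa using this
  have h7 : (N / 2 * M + K) * 1 ≤ (N / 2 * M + K) * Q :=
    mul_le_mul_of_nonneg_left hQ1 (by
      have : 0 < N / 2 * M := mul_pos (by linarith) hM
      linarith)
  have h8 : (N / 2 * M + K + K / (1 - θ)) * Q = (N / 2 * M + K) * Q + K * Q * (1 / (1 - θ)) := by
    ring
  linarith

theorem main_ind (N : ℝ) (hN : 4 ≤ N) (s : ℕ) (hs : 1 ≤ s) (h2s : N / 2 < 2 * s) (k : ℕ) :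
    ∀ j : ℕ, j + k + 1 = s → ∃ C > (0:ℝ), ∀ y : ℝ → ℝ, ContDiff ℝ (⊤ : ℕ∞) y → ∀ M > (0:ℝ),
      (∀ i ≤ s, Xnorm N (DelIter N i y) ≤ M) → ∀ z, 0 < z → z ≤ 1 →
      |DelIter N j y z| ≤ C * M * z ^ (-(N / 2 / 2 / s * j)) := by
  have hs0 : (0:ℝ) < s := by exact_mod_cast hs
  set θ := N / 2 / 2 / s with hθ
  have hθ0 : 0 < θ := by have : 0 < N := by linarith
                         positivity
  have hθ1 : θ < 1 := by rw [hθ, div_lt_one hs0]; linarith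
  have hθs : θ * s = N / 2 / 2 := by rw [hθ]; field_simp
  have hth : 0 < 1 - θ := by linarith
  have step : ∀ j : ℕ, j + 1 ≤ s → ∀ C > (0:ℝ), (∀ y : ℝ → ℝ, ContDiff ℝ (⊤ : ℕ∞) y → ∀ M > (0:ℝ),
      (∀ i ≤ s, Xnorm N (DelIter N i y) ≤ M) → ∀ z, 0 < z → z ≤ 1 →
      |deriv (DelIter N j y) z| ≤ C * M * z ^ (-(θ * ((j + 1 : ℕ) : ℝ)))) →
      ∃ C > (0:ℝ), ∀ y : ℝ → ℝ, ContDiff ℝ (⊤ : ℕ∞) y → ∀ M > (0:ℝ),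
      (∀ i ≤ s, Xnorm N (DelIter N i y) ≤ M) → ∀ z, 0 < z → z ≤ 1 →
      |DelIter N j y z| ≤ C * M * z ^ (-(θ * j)) := by
    intro j hj C hC hd
    refine ⟨N / 2 + C + C / (1 - θ), by have : 0 < N := by linarith
                                        positivity, ?_⟩
    intro y hy M hM hX z hz hz1
    have hjs : ((j + 1 : ℕ) : ℝ) ≤ s := by exact_mod_cast hj
    have h := pt_of_deriv N hN (DelIter N j y) (DelIter_smooth N y hy j) M hM (hX j (by omega))
      (C * M) (θ * ((j + 1 : ℕ) : ℝ)) θ (by positivity)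
      (by rw [← hθs]; exact mul_le_mul_of_nonneg_left hjs hθ0.le) hθ1
      (by push_cast; nlinarith [mul_nonneg hθ0.le (Nat.cast_nonneg (α := ℝ) j)])
      (hd y hy M hM hX) z hz hz1
    have e : θ * ((j + 1 : ℕ) : ℝ) - θ = θ * j := by push_cast; ring
    rw [e] at h
    calc _ ≤ _ := h
      _ = _ := by ring
  induction k with
  | zero =>
    intro j hj
    refine step j (by omega) 1 one_pos ?_
    intro y hy M hM hX z hz hz1
    have hj' : j + 1 = s := by omega
    rw [hj', hθs, one_mul]
    refine deriv_of_X N hN _ (DelIter_smooth N y hy j) (DelIter_smooth N y hy (j+1)).continuous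
      M hM (hX (j+1) (by omega)) z hz hz1
  | succ k ih =>
    intro j hj
    obtain ⟨C, hC, h⟩ := ih (j + 1) (by omega)
    refine step j (by omega) C hC ?_
    intro y hy M hM hX z hz hz1
    have hjs : ((j + 1 : ℕ) : ℝ) ≤ s := by exact_mod_cast (by omega : j + 1 ≤ s)
    exact deriv_of_pt N hN _ (DelIter_smooth N y hy j) (C * M) _ (by positivity)
      (by rw [← hθs]; exact mul_le_mul_of_nonneg_left hjs hθ0.le)
      (h y hy M hM hX) z hz hz1

theorem stmt17 (N : ℝ) (hN : 4 ≤ N) (s : ℕ) (hs : 1 ≤ s) (h2s : N / 2 < 2 * s) :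
    ∃ C > (0:ℝ), ∀ y : ℝ → ℝ, ContDiff ℝ (⊤ : ℕ∞) y →
      supN y ≤ C * ⨆ j : Fin (s + 1), Xnorm N (DelIter N j.1 y) := by
  obtain ⟨C, hC, h⟩ := main_ind N hN s hs h2s (s - 1) 0 (by omega)
  refine ⟨C, hC, ?_⟩
  intro y hy
  set S := ⨆ j : Fin (s + 1), Xnorm N (DelIter N j.1 y) with hS
  have hle : ∀ i ≤ s, Xnorm N (DelIter N i y) ≤ S := fun i hi =>
    le_ciSup (f := fun j : Fin (s + 1) => Xnorm N (DelIter N j.1 y))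
      (Set.finite_range _).bddAbove ⟨i, by omega⟩
  have hS0 : 0 ≤ S := (Real.sqrt_nonneg _).trans (hle 0 (Nat.zero_le _))
  have hpos : ∀ z ∈ Ioc (0:ℝ) 1, |y z| ≤ C * S := by
    intro z hz
    apply le_of_forall_pos_le_add
    intro ε hε
    have hM : 0 < S + ε / C := by positivity
    have := h y hy (S + ε / C) hM
      (fun i hi => (hle i hi).trans (by have : 0 < ε / C := by positivity
                                        linarith)) z hz.1 hz.2
    simp only [Nat.cast_zero, mul_zero, neg_zero, Real.rpow_zero, mul_one, DelIter] at this
    refine this.trans_eq ?_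
    field_simp
  have hall : ∀ z ∈ Icc (0:ℝ) 1, |y z| ≤ C * S := by
    intro z hz
    rw [← closure_Ioc (zero_ne_one)] at hz
    exact closure_minimal (t := {z | |y z| ≤ C * S}) hpos
      (isClosed_le hy.continuous.abs continuous_const) hz
  haveI : Nonempty (Icc (0:ℝ) 1) := ⟨⟨0, by simp⟩⟩
  exact ciSup_le (fun z => hall z.1 z.2)
end

section
/- Let N ≥ 4 be a real number and let y ∈ C^∞([0,1]). Then for all k, j ∈ ℕ: ‖Ḋ^k D^j y‖_{L^∞(0,1)} ≤ (2/(k+1))^j · ‖Ḋ^{k+2j} y‖_{L^∞(0,1)}. In particular, for every k ∈ ℕ and z ∈ (0,1]: (Ḋ^k(Dy))(z) = z^{−(N+k)/2} ∫_0^z (Ḋ^k Δy)(z')·(z')^{(N+k)/2 − 1} dz'. -/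
open MeasureTheory Real Set

/-- Smooth functions of the square root on the positive half line. -/
def SqS (f : ℝ → ℝ) : Prop :=
  ∃ F : ℝ → ℝ, ContDiff ℝ (⊤ : ℕ∞) F ∧ ∀ z, 0 < z → f z = F (Real.sqrt z)

lemma SqS.of_smooth {f : ℝ → ℝ} (hf : ContDiff ℝ (⊤ : ℕ∞) f) : SqS f := by
  refine ⟨fun s => f (s ^ 2), hf.comp (contDiff_id.pow 2), fun z hz => ?_⟩
  simp only [Real.sq_sqrt hz.le]

lemma smooth_deriv {f : ℝ → ℝ} (hf : ContDiff ℝ (⊤ : ℕ∞) f) : ContDiff ℝ (⊤ : ℕ∞) (deriv f) := by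
  have := (contDiff_infty_iff_deriv (f := f)).1 hf
  exact this.2

lemma deriv_congr_pos {f g : ℝ → ℝ} (h : ∀ z, 0 < z → f z = g z) {z : ℝ} (hz : 0 < z) :
    deriv f z = deriv g z := by
  apply Filter.EventuallyEq.deriv_eq
  filter_upwards [lt_mem_nhds hz] with w hw using h w hw

lemma Ddot_congr {f g : ℝ → ℝ} (h : ∀ z, 0 < z → f z = g z) (z : ℝ) (hz : 0 < z) :
    Ddot f z = Ddot g z := by
  simp only [Ddot, deriv_congr_pos h hz]

lemma Ddot_iter_congr {f g : ℝ → ℝ} (k : ℕ) (h : ∀ z, 0 < z → f z = g z) (z : ℝ) (hz : 0 < z) :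
    Ddot^[k] f z = Ddot^[k] g z := by
  induction k generalizing z with
  | zero => exact h z hz
  | succ k ih =>
    rw [Function.iterate_succ_apply', Function.iterate_succ_apply']
    exact Ddot_congr ih z hz

lemma SqS.ddot {f : ℝ → ℝ} (hf : SqS f) : SqS (Ddot f) := by
  obtain ⟨F, hF, h⟩ := hf
  refine ⟨fun s => deriv F s / 2, (smooth_deriv hF).div_const 2, fun z hz => ?_⟩
  rw [Ddot_congr h z hz]
  have hs : Real.sqrt z ≠ 0 := (Real.sqrt_pos.2 hz).ne'
  have hd : HasDerivAt (fun z => F (Real.sqrt z)) (deriv F (√z) * (1 / (2 * √z))) z :=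
    HasDerivAt.comp z ((hF.differentiable (by simp)) _).hasDerivAt (Real.hasDerivAt_sqrt hz.ne')
  simp only [Ddot, hd.deriv]
  field_simp

lemma SqS.iter {f : ℝ → ℝ} (hf : SqS f) (k : ℕ) : SqS (Ddot^[k] f) := by
  induction k with
  | zero => exact hf
  | succ k ih => rw [Function.iterate_succ_apply']; exact ih.ddot

lemma SqS.contDiffAt {f : ℝ → ℝ} (hf : SqS f) {z : ℝ} (hz : 0 < z) :
    ContDiffAt ℝ (⊤ : ℕ∞) f z := by
  obtain ⟨F, hF, h⟩ := hf
  have : ContDiffAt ℝ (⊤ : ℕ∞) (fun z => F (Real.sqrt z)) z :=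
    hF.contDiffAt.comp z (Real.contDiffAt_sqrt hz.ne')
  refine this.congr_of_eventuallyEq ?_
  filter_upwards [lt_mem_nhds hz] with w hw using h w hw

lemma SqS.diff {f : ℝ → ℝ} (hf : SqS f) {z : ℝ} (hz : 0 < z) : DifferentiableAt ℝ f z :=
  (hf.contDiffAt hz).differentiableAt (by simp)

lemma SqS.diff2 {f : ℝ → ℝ} (hf : SqS f) {z : ℝ} (hz : 0 < z) :
    DifferentiableAt ℝ (deriv f) z := by

  have h2 : ContDiffAt ℝ 2 f z :=
    (hf.contDiffAt hz).of_le (WithTop.coe_le_coe.2 (le_top : (2 : ℕ∞) ≤ ⊤))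
  exact (h2.derivWithin (m := 1) (by norm_num)).differentiableAt (by simp)

lemma SqS.bdd {f : ℝ → ℝ} (hf : SqS f) : BddAbove (range fun z : Icc (0:ℝ) 1 => |f z.1|) := by
  obtain ⟨F, hF, h⟩ := hf
  have hc : ContinuousOn (fun z => F (Real.sqrt z)) (Icc 0 1) :=
    (hF.continuous.comp Real.continuous_sqrt).continuousOn
  obtain ⟨C, hC⟩ := isCompact_Icc.exists_bound_of_continuousOn hc
  refine ⟨max C |f 0|, ?_⟩
  rintro _ ⟨⟨z, hz⟩, rfl⟩
  rcases hz.1.eq_or_lt with h0 | h0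
  · simp [← h0]
  · exact le_max_of_le_left (by simpa [h z h0] using hC z hz)

lemma SqS.le_supN {f : ℝ → ℝ} (hf : SqS f) {z : ℝ} (hz : z ∈ Icc (0:ℝ) 1) : |f z| ≤ supN f :=
  le_ciSup hf.bdd ⟨z, hz⟩

lemma commut {g w : ℝ → ℝ} (hg : SqS g) (c : ℝ)
    (hw : ∀ z, 0 < z → w z = z * deriv g z + c * g z) (k : ℕ) :
    ∀ z, 0 < z → Ddot^[k] w z
      = z * deriv (Ddot^[k] g) z + (c + k / 2) * Ddot^[k] g z := by
  induction k with
  | zero => simpa using hw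
  | succ k ih =>
    intro z hz
    rw [Function.iterate_succ_apply', Function.iterate_succ_apply', Ddot_congr ih z hz]
    have hu := hg.iter k
    set u := Ddot^[k] g
    have h1 : HasDerivAt u (deriv u z) z := (hu.diff hz).hasDerivAt
    have h2 : HasDerivAt (deriv u) (deriv (deriv u) z) z := (hu.diff2 hz).hasDerivAt
    have h3 := ((hasDerivAt_id z).mul h2).add (h1.const_mul (c + k / 2))
    have h4 := (Real.hasDerivAt_sqrt hz.ne').mul h2
    have e3 : deriv (fun z => z * deriv u z + (c + k / 2) * u z) z
      = 1 * deriv u z + z * deriv (deriv u) z + (c + k / 2) * deriv u z := h3.deriv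
    have e4 : deriv (Ddot u) z = 1 / (2 * √z) * deriv u z + √z * deriv (deriv u) z := h4.deriv
    rw [e4]
    simp only [Ddot, e3]
    have hs : Real.sqrt z ≠ 0 := (Real.sqrt_pos.2 hz).ne'
    have hz2 : z = √z ^ 2 := (Real.sq_sqrt hz.le).symm
    push_cast
    have : z * (1 / (2 * √z) * deriv u z) = √z * deriv u z / 2 := by
      nth_rewrite 1 [hz2]; field_simp
    linear_combination -this

lemma integ {u v : ℝ → ℝ} (hu : SqS u) (hv : SqS v) {a : ℝ} (ha : 0 < a)
    (h : ∀ z, 0 < z → v z = z * deriv u z + a * u z) {z : ℝ} (hz : 0 < z) :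
    IntervalIntegrable (fun ζ => v ζ * ζ ^ (a - 1)) volume 0 z ∧
    ∫ ζ in (0:ℝ)..z, v ζ * ζ ^ (a - 1) = z ^ a * u z := by
  obtain ⟨U, hU, hUu⟩ := id hu
  obtain ⟨V, hV, hVv⟩ := id hv
  have hi : IntervalIntegrable (fun ζ => v ζ * ζ ^ (a - 1)) volume 0 z := by
    have h1 : IntervalIntegrable (fun ζ : ℝ => V (√ζ) * ζ ^ (a - 1)) volume 0 z :=
      (intervalIntegral.intervalIntegrable_rpow' (by linarith)).continuousOn_mul
        (hV.continuous.comp Real.continuous_sqrt).continuousOn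
    refine h1.congr ?_
    intro ζ hζ
    rw [uIoc_of_le hz.le] at hζ
    simp only [hVv ζ hζ.1]
  refine ⟨hi, ?_⟩
  have := intervalIntegral.integral_eq_sub_of_hasDerivAt_of_le (f := fun ζ => ζ ^ a * U (√ζ))
    (f' := fun ζ => v ζ * ζ ^ (a - 1)) hz.le
    ((Real.continuous_rpow_const ha.le).mul
      (hU.continuous.comp Real.continuous_sqrt)).continuousOn ?_ hi
  · rw [this, Real.zero_rpow ha.ne', hUu z hz]; ring
  · intro x hx
    have h1 := (Real.hasDerivAt_rpow_const (x := x) (p := a) (Or.inl hx.1.ne')).mul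
      (hu.diff hx.1).hasDerivAt
    have h2 : HasDerivAt (fun ζ => ζ ^ a * U (√ζ)) (a * x ^ (a - 1) * u x + x ^ a * deriv u x) x := by
      refine h1.congr_of_eventuallyEq ?_
      filter_upwards [lt_mem_nhds hx.1] with w hw
      simp [hUu w hw]
    have h3 : x ^ a = x ^ (a - 1) * x := by
      rw [← Real.rpow_add_one hx.1.ne']; ring_nf
    have h4 : v x * x ^ (a - 1) = a * x ^ (a - 1) * u x + x ^ a * deriv u x := by
      rw [h x hx.1, h3]; ring
    rw [← h4] at h2
    exact h2

lemma estim {u v : ℝ → ℝ} (hu : SqS u) (hv : SqS v) {a : ℝ} (ha : 0 < a)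
    (h : ∀ z, 0 < z → v z = z * deriv u z + a * u z) {z : ℝ} (hz : z ∈ Ioc (0:ℝ) 1) :
    |u z| ≤ 1 / a * supN v := by
  obtain ⟨h1, h2⟩ := integ hu hv ha h hz.1
  have hi : ∫ ζ in (0:ℝ)..z, supN v * ζ ^ (a - 1) = supN v * (z ^ a / a) := by
    rw [intervalIntegral.integral_const_mul, integral_rpow (Or.inl (by linarith))]
    simp [Real.zero_rpow ha.ne']
  have h3 : ‖∫ ζ in (0:ℝ)..z, v ζ * ζ ^ (a - 1)‖ ≤ ∫ ζ in (0:ℝ)..z, supN v * ζ ^ (a - 1) := by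
    apply intervalIntegral.norm_integral_le_of_norm_le hz.1.le
    · refine Filter.Eventually.of_forall fun ζ hζ => ?_
      have hp : 0 ≤ ζ ^ (a - 1) := Real.rpow_nonneg hζ.1.le _
      rw [norm_mul, Real.norm_eq_abs, Real.norm_of_nonneg hp]
      exact mul_le_mul_of_nonneg_right (hv.le_supN ⟨hζ.1.le, hζ.2.trans hz.2⟩) hp
    · exact (intervalIntegral.intervalIntegrable_rpow' (by linarith)).const_mul _
  have hp : 0 < z ^ a := Real.rpow_pos_of_pos hz.1 _
  rw [h2, hi, norm_mul, Real.norm_of_nonneg hp.le, Real.norm_eq_abs] at h3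
  have : z ^ a * |u z| ≤ z ^ a * (1 / a * supN v) := by
    calc _ ≤ _ := h3
      _ = _ := by ring
  exact le_of_mul_le_mul_left this hp

lemma ddot_two {f : ℝ → ℝ} (hf : ContDiff ℝ (⊤ : ℕ∞) f) (z : ℝ) (hz : 0 < z) :
    Ddot^[2] f z = z * deriv (deriv f) z + 1 / 2 * deriv f z := by
  have h2 : HasDerivAt (deriv f) (deriv (deriv f) z) z :=
    ((smooth_deriv hf).differentiable (by simp) z).hasDerivAt
  have h4 := (Real.hasDerivAt_sqrt hz.ne').mul h2
  have e4 : deriv (Ddot f) z = 1 / (2 * √z) * deriv f z + √z * deriv (deriv f) z := h4.deriv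
  change √z * deriv (Ddot f) z = _
  rw [e4]
  have hs : Real.sqrt z ≠ 0 := (Real.sqrt_pos.2 hz).ne'
  have hz2 : √z * √z = z := Real.mul_self_sqrt hz.le
  have : √z * (1 / (2 * √z) * deriv f z) = 1 / 2 * deriv f z := by field_simp
  linear_combination this + deriv (deriv f) z * hz2

lemma step {f : ℝ → ℝ} (hf : ContDiff ℝ (⊤ : ℕ∞) f) (k : ℕ) :
    supN (Ddot^[k] (deriv f)) ≤ 2 / ((k:ℝ) + 1) * supN (Ddot^[k + 2] f) := by
  have hg : SqS (deriv f) := SqS.of_smooth (smooth_deriv hf)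
  have hc := commut hg (1 / 2) (ddot_two hf) k
  rw [← Function.iterate_add_apply] at hc
  have ha : (0:ℝ) < 1 / 2 + k / 2 := by positivity
  have hv : SqS (Ddot^[k + 2] f) := (SqS.of_smooth hf).iter _
  have hE : ∀ z ∈ Ioc (0:ℝ) 1, |Ddot^[k] (deriv f) z| ≤ 2 / ((k:ℝ) + 1) * supN (Ddot^[k + 2] f) := by
    intro z hz
    have := estim (hg.iter k) hv ha hc hz
    convert this using 2
    field_simp
    ring
  have hM : 0 ≤ 2 / ((k:ℝ) + 1) * supN (Ddot^[k + 2] f) :=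
    (abs_nonneg _).trans (hE 1 (by simp))
  refine ciSup_le ?_
  rintro ⟨z, hz⟩
  rcases hz.1.eq_or_lt with h0 | h0
  · subst h0
    cases k with
    | zero =>
      have hcont : Continuous (fun z => |deriv f z|) := (smooth_deriv hf).continuous.abs
      refine le_of_tendsto (hcont.continuousWithinAt (s := Ioi 0) (x := 0)) ?_
      filter_upwards [Ioc_mem_nhdsGT (zero_lt_one (α := ℝ))] with w hw using hE w hw
    | succ k =>
      rw [Function.iterate_succ_apply']
      simpa [Ddot] using hM
  · exact hE z ⟨h0, hz.2⟩

lemma smooth_iter {f : ℝ → ℝ} (hf : ContDiff ℝ (⊤ : ℕ∞) f) (j : ℕ) :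
    ContDiff ℝ (⊤ : ℕ∞) (deriv^[j] f) := by
  induction j with
  | zero => exact hf
  | succ j ih => rw [Function.iterate_succ_apply']; exact smooth_deriv ih

lemma supN_nonneg (f : ℝ → ℝ) : 0 ≤ supN f := Real.iSup_nonneg fun _ => abs_nonneg _

lemma part1 {y : ℝ → ℝ} (hy : ContDiff ℝ (⊤ : ℕ∞) y) (j : ℕ) : ∀ k : ℕ,
    supN (Ddot^[k] (deriv^[j] y))
        ≤ (2 / ((k:ℝ) + 1)) ^ j * supN (Ddot^[k + 2 * j] y) := by
  induction j with
  | zero => intro k; simp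
  | succ j ih =>
    intro k
    rw [Function.iterate_succ_apply']
    refine (step (smooth_iter hy j) k).trans ?_
    have h1 := ih (k + 2)
    have h2 : (2 / (((k + 2 : ℕ):ℝ) + 1)) ^ j ≤ (2 / ((k:ℝ) + 1)) ^ j := by
      apply pow_le_pow_left₀ (by positivity)
      apply div_le_div_of_nonneg_left (by norm_num) (by positivity)
      push_cast; linarith
    have e : k + 2 * (j + 1) = k + 2 + 2 * j := by ring
    rw [e, pow_succ']
    rw [mul_assoc]
    refine mul_le_mul_of_nonneg_left ?_ (by positivity)
    exact h1.trans (mul_le_mul_of_nonneg_right h2 (supN_nonneg _))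

theorem stmt18 (N : ℝ) (hN : 4 ≤ N) (y : ℝ → ℝ) (hy : ContDiff ℝ (⊤ : ℕ∞) y) :
    (∀ k j : ℕ,
      supN (Ddot^[k] (deriv^[j] y))
        ≤ (2 / ((k:ℝ) + 1)) ^ j * supN (Ddot^[k + 2 * j] y)) ∧
    (∀ k : ℕ, ∀ z ∈ Ioc (0:ℝ) 1,
      Ddot^[k] (deriv y) z
        = z ^ (-((N + (k:ℝ)) / 2))
            * ∫ ζ in (0:ℝ)..z, Ddot^[k] (Del N y) ζ * ζ ^ ((N + (k:ℝ)) / 2 - 1)) := by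
  refine ⟨fun k j => part1 hy j k, fun k z hz => ?_⟩
  have hg : SqS (deriv y) := SqS.of_smooth (smooth_deriv hy)
  have hD : ContDiff ℝ (⊤ : ℕ∞) (Del N y) :=
    (contDiff_id.mul (smooth_deriv (smooth_deriv hy))).add
      (contDiff_const.mul (smooth_deriv hy))
  have hc := commut (w := Del N y) hg (N / 2) (fun z _ => rfl) k
  have e : N / 2 + (k:ℝ) / 2 = (N + k) / 2 := by ring
  rw [e] at hc
  have ha : 0 < (N + (k:ℝ)) / 2 := by positivity
  rw [(integ (hg.iter k) ((SqS.of_smooth hD).iter k) ha hc hz.1).2, ← mul_assoc,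
    ← Real.rpow_add hz.1]
  simp
end
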